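/- arXiv:1903.00209 — 2 statements merged into one kernel-verified Lean document; each statement's English description precedes it below -/
import Mathlib

section
/- Let n ≥ 4, p ≥ 1, let H_1,…,H_p be real symmetric n×n matrices and c ≥ 0 a real number. Set τ_n = (−1)ⁿ+3. Assume R > n(n−2)(c+H²) and Ric(u) ≤ (n−2+2τ_n/(2n+τ_n))(c+H²) for every unit vector u ∈ ℝⁿ. Then for every integer q with 2 ≤ q ≤ n/2 and every orthonormal basis e_1,…,e_n of ℝⁿ, Σ_{k=q+1}^n Σ_{i=1}^q [2‖h(e_i,e_k)‖² − ⟨h(e_i,e_i), h(e_k,e_k)⟩] < q(n−q)c. -/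
open Matrix BigOperators

noncomputable section

/-- Squared mean curvature `H² = Σ_α (tr H_α / n)²`. -/
def meanCurvSq (n p : ℕ) (Hm : Fin p → Matrix (Fin n) (Fin n) ℝ) : ℝ :=
  ∑ α, ((Hm α).trace / n) ^ 2

/-- `S = Σ_α ‖H_α‖²` (squared Frobenius norm of the second fundamental form). -/
def sqNormSff (n p : ℕ) (Hm : Fin p → Matrix (Fin n) (Fin n) ℝ) : ℝ :=
  ∑ α, ∑ i, ∑ j, (Hm α i j) ^ 2

/-- Scalar curvature `R = n(n−1)c + n²H² − S`. -/
def scalarCurv (n p : ℕ) (Hm : Fin p → Matrix (Fin n) (Fin n) ℝ) (c : ℝ) : ℝ :=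
  n * (n - 1) * c + n ^ 2 * meanCurvSq n p Hm - sqNormSff n p Hm

/-- Ricci curvature of a unit vector `u`, via the Gauss equation:
`Ric(u) = (n−1)c + Σ_α (tr(H_α)⟨H_α u,u⟩ − ‖H_α u‖²)`. -/
def ricci (n p : ℕ) (Hm : Fin p → Matrix (Fin n) (Fin n) ℝ) (c : ℝ) (u : Fin n → ℝ) : ℝ :=
  (n - 1) * c + ∑ α, ((Hm α).trace * ((Hm α).mulVec u ⬝ᵥ u)
    - (Hm α).mulVec u ⬝ᵥ (Hm α).mulVec u)

/-- Second fundamental form `h(u,v) = (⟨H_1 u,v⟩,…,⟨H_p u,v⟩) ∈ ℝ^p`. -/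
def sff (n p : ℕ) (Hm : Fin p → Matrix (Fin n) (Fin n) ℝ) (u v : Fin n → ℝ) : Fin p → ℝ :=
  fun α => (Hm α).mulVec u ⬝ᵥ v

/-- Euclidean inner product `⟨h(u,v), h(w,z)⟩` in `ℝ^p`. -/
def sffInner (n p : ℕ) (Hm : Fin p → Matrix (Fin n) (Fin n) ℝ) (u v w z : Fin n → ℝ) : ℝ :=
  ∑ α, sff n p Hm u v α * sff n p Hm w z α

/-- The algebraic core of the block estimate: `X`, `Y`, `N` stand for the squared norms of the two
diagonal blocks and of the off-diagonal block of a symmetric matrix, `A`, `B` for the traces of the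
diagonal blocks, of sizes `q` and `m`, and `t` for the normalized trace. -/
lemma block_scalar_estimate {q m r t A B X Y N : ℝ} (hq : 2 ≤ q) (hqm : q ≤ m)
    (hr : r * (q + m - 2) = m - q) (ht : (q + m) * t = A + B) (hN : 0 ≤ N)
    (hX : A ^ 2 ≤ q * X) (hY : B ^ 2 ≤ m * Y) :
    2 * N - A * B ≤ q * (m + r) / (q + m) * (X + Y + 2 * N - (q + m) * t ^ 2) - q * m * t ^ 2
      + r * ((A + B) * B - (Y + N) - m * (q + m - 1) * t ^ 2) := by
  have hs : 0 < q + m := by linarith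
  have hr0 : 0 ≤ r := by
    by_contra! h
    nlinarith
  have hr1 : r ≤ 1 := by
    by_contra! h
    nlinarith
  have hcN : 0 ≤ (q * (2 * m + r) - m * r) - 2 * (q + m) := by
    have h1 : (m - q) * r ≤ m + q - 4 := by nlinarith
    nlinarith [mul_nonneg (sub_nonneg.2 hq) (sub_nonneg.2 (hq.trans hqm))]
  obtain ⟨a, rfl⟩ : ∃ a, A = q * t + a := ⟨A - q * t, by ring⟩
  obtain rfl : B = m * t - a := by linarith
  have hXc : 0 ≤ (m + r) * (q * X - (q * t + a) ^ 2) :=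
    mul_nonneg (by linarith) (by linarith)
  have hYc : 0 ≤ (q - r) * (m * Y - (m * t - a) ^ 2) :=
    mul_nonneg (by linarith) (by linarith)
  have key : 0 ≤ (m + r) * (q * X - (q * t + a) ^ 2) + (q - r) * (m * Y - (m * t - a) ^ 2)
      + ((q * (2 * m + r) - m * r) - 2 * (q + m)) * N := by positivity
  rw [← sub_nonneg]
  refine (div_nonneg key hs.le).trans_eq ?_
  field_simp
  linear_combination ((q + m) * a * t) * hr

/-- Estimate of the Lawson–Simons expression of a single symmetric matrix by its traceless norm and
the partial sum of its Ricci-type terms over the larger block. -/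
lemma lawsonSimons_le {ι : Type*} [Fintype ι] [DecidableEq ι] (M : Matrix ι ι ℝ) (hM : M.IsSymm)
    (s : Finset ι) {q m r t : ℝ} (hs : (s.card : ℝ) = q) (hsc : (sᶜ.card : ℝ) = m)
    (hq : 2 ≤ q) (hqm : q ≤ m) (hr : r * (q + m - 2) = m - q) (ht : (q + m) * t = M.trace) :
    ∑ k ∈ sᶜ, ∑ i ∈ s, (2 * (M i k * M i k) - M i i * M k k) ≤
      q * (m + r) / (q + m) * (∑ i, ∑ j, M i j ^ 2 - (q + m) * t ^ 2) - q * m * t ^ 2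
      + r * (∑ k ∈ sᶜ, (M.trace * M k k - ∑ j, M k j ^ 2) - m * (q + m - 1) * t ^ 2) := by
  have diag : ∀ u : Finset ι, (∑ i ∈ u, M i i) ^ 2 ≤ u.card * ∑ i ∈ u, ∑ j ∈ u, M i j ^ 2 := by
    intro u
    refine sq_sum_le_card_mul_sum_sq.trans (mul_le_mul_of_nonneg_left ?_ (by positivity))
    exact Finset.sum_le_sum fun i hi =>
      Finset.single_le_sum (f := fun j => M i j ^ 2) (fun j _ => sq_nonneg _) hi
  have htr : M.trace = ∑ i ∈ s, M i i + ∑ k ∈ sᶜ, M k k :=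
    (Finset.sum_add_sum_compl s fun i => M i i).symm
  have hrow : ∀ i, ∑ j, M i j ^ 2 = ∑ j ∈ s, M i j ^ 2 + ∑ j ∈ sᶜ, M i j ^ 2 := fun i =>
    (Finset.sum_add_sum_compl s fun j => M i j ^ 2).symm
  have hoff : ∑ i ∈ s, ∑ k ∈ sᶜ, M i k ^ 2 = ∑ k ∈ sᶜ, ∑ i ∈ s, M k i ^ 2 := by
    rw [Finset.sum_comm]
    simp_rw [fun i j => hM.apply i j]
  have hall : ∑ i, ∑ j, M i j ^ 2 = ∑ i ∈ s, ∑ j ∈ s, M i j ^ 2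
      + ∑ k ∈ sᶜ, ∑ l ∈ sᶜ, M k l ^ 2 + 2 * ∑ k ∈ sᶜ, ∑ i ∈ s, M k i ^ 2 := by
    rw [← Finset.sum_add_sum_compl s]
    simp_rw [hrow, Finset.sum_add_distrib]
    rw [hoff]
    ring
  have hric : ∑ k ∈ sᶜ, (M.trace * M k k - ∑ j, M k j ^ 2) =
      (∑ i ∈ s, M i i + ∑ k ∈ sᶜ, M k k) * ∑ k ∈ sᶜ, M k k
      - (∑ k ∈ sᶜ, ∑ l ∈ sᶜ, M k l ^ 2 + ∑ k ∈ sᶜ, ∑ i ∈ s, M k i ^ 2) := by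
    simp_rw [hrow, Finset.sum_sub_distrib, Finset.sum_add_distrib, ← Finset.mul_sum, htr]
    ring
  have hls : ∑ k ∈ sᶜ, ∑ i ∈ s, (2 * (M i k * M i k) - M i i * M k k) =
      2 * ∑ k ∈ sᶜ, ∑ i ∈ s, M k i ^ 2 - (∑ i ∈ s, M i i) * ∑ k ∈ sᶜ, M k k := by
    simp_rw [Finset.sum_sub_distrib, ← Finset.sum_mul, ← Finset.mul_sum, fun i j => hM.apply j i,
      sq]
  rw [hls, hall, hric]
  refine block_scalar_estimate hq hqm hr (ht.trans htr) (by positivity) ?_ ?_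
  · exact hs ▸ diag s
  · exact hsc ▸ diag sᶜ

/-- The pinching constant of the Ricci bound controls every block size below the middle one. -/
lemma le_mul_one_sub_pinching {n q : ℕ} (hn : 4 ≤ n) (hqn : 2 * q < n) :
    (q : ℝ) ≤ ((n : ℝ) - q) *
      (1 - 2 * ((-1 : ℝ) ^ n + 3) / (2 * (n : ℝ) + ((-1 : ℝ) ^ n + 3))) := by
  have hn' : (4 : ℝ) ≤ n := by exact_mod_cast hn
  rcases Nat.even_or_odd n with h | h
  · have h2 : 2 * q + 2 ≤ n := by
      obtain ⟨k, rfl⟩ := h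
      omega
    have h2' : 2 * (q : ℝ) + 2 ≤ n := by exact_mod_cast h2
    rw [h.neg_one_pow, one_sub_div (by linarith), ← mul_div_assoc, le_div_iff₀ (by linarith)]
    nlinarith
  · have h2' : 2 * (q : ℝ) + 1 ≤ n := by exact_mod_cast hqn
    rw [h.neg_one_pow, one_sub_div (by linarith), ← mul_div_assoc, le_div_iff₀ (by linarith)]
    nlinarith

/-- Change of an orthonormal frame for a bilinear form given by a matrix. -/
lemma mulVec_dotProduct_eq_conj {ι : Type*} [Fintype ι] (A E : Matrix ι ι ℝ) (i j : ι) :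
    A.mulVec (E i) ⬝ᵥ E j = (E * A * Eᵀ) j i := by
  rw [dotProduct_comm, Matrix.mul_assoc, Matrix.mul_apply]
  simp only [dotProduct, Matrix.mulVec, Matrix.mul_apply, Matrix.transpose_apply]

lemma sum_sq_eq_trace_mul_transpose {ι : Type*} [Fintype ι] (A : Matrix ι ι ℝ) :
    ∑ i, ∑ j, A i j ^ 2 = (A * Aᵀ).trace := by
  simp [Matrix.trace, Matrix.mul_apply, sq]

lemma trace_conj_of_orthogonal {ι : Type*} [Fintype ι] [DecidableEq ι] {E : Matrix ι ι ℝ}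
    (hE : E * Eᵀ = 1) (A : Matrix ι ι ℝ) : (E * A * Eᵀ).trace = A.trace := by
  rw [Matrix.trace_mul_comm, ← Matrix.mul_assoc, mul_eq_one_comm.1 hE, Matrix.one_mul]

lemma sum_sq_conj_of_orthogonal {ι : Type*} [Fintype ι] [DecidableEq ι] {E : Matrix ι ι ℝ}
    (hE : E * Eᵀ = 1) (A : Matrix ι ι ℝ) :
    ∑ i, ∑ j, (E * A * Eᵀ) i j ^ 2 = ∑ i, ∑ j, A i j ^ 2 := by
  rw [sum_sq_eq_trace_mul_transpose, sum_sq_eq_trace_mul_transpose,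
    ← trace_conj_of_orthogonal hE (A * Aᵀ)]
  congr 1
  simp only [Matrix.transpose_mul, Matrix.transpose_transpose, Matrix.mul_assoc]
  rw [← Matrix.mul_assoc Eᵀ E, mul_eq_one_comm.1 hE, Matrix.one_mul]

lemma mulVec_dotProduct_self_eq_sum_conj {ι : Type*} [Fintype ι] [DecidableEq ι]
    {A E : Matrix ι ι ℝ} (hE : E * Eᵀ = 1) (hA : A.IsSymm) (k : ι) :
    A.mulVec (E k) ⬝ᵥ A.mulVec (E k) = ∑ j, (E * A * Eᵀ) k j ^ 2 := by
  have h1 : ∑ j, (E * A * Eᵀ) k j ^ 2 = ((E * A * Eᵀ) * (E * A * Eᵀ)ᵀ) k k :=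
    Finset.sum_congr rfl fun _ _ => sq _
  have h2 : (E * A * Eᵀ) * (E * A * Eᵀ)ᵀ = E * (A * A) * Eᵀ := by
    simp only [Matrix.transpose_mul, Matrix.transpose_transpose, Matrix.mul_assoc, hA.eq]
    rw [← Matrix.mul_assoc Eᵀ E, mul_eq_one_comm.1 hE, Matrix.one_mul]
  rw [h1, h2, ← mulVec_dotProduct_eq_conj, ← Matrix.mulVec_mulVec, Matrix.dotProduct_mulVec,
    ← Matrix.mulVec_transpose, hA.eq]

theorem stmt_16 (n p : ℕ) (hn : 4 ≤ n) (hp : 1 ≤ p)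
    (Hm : Fin p → Matrix (Fin n) (Fin n) ℝ) (hsym : ∀ α, (Hm α).IsSymm)
    (c : ℝ) (hc : 0 ≤ c)
    (hR : scalarCurv n p Hm c > (n : ℝ) * ((n : ℝ) - 2) * (c + meanCurvSq n p Hm))
    (hRic : ∀ u : Fin n → ℝ, u ⬝ᵥ u = 1 →
      ricci n p Hm c u ≤
        ((n : ℝ) - 2 + 2 * ((-1 : ℝ) ^ n + 3) / (2 * (n : ℝ) + ((-1 : ℝ) ^ n + 3)))
          * (c + meanCurvSq n p Hm)) :
    ∀ q : ℕ, 2 ≤ q → 2 * q ≤ n →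
      ∀ e : Fin n → Fin n → ℝ, (∀ i j, e i ⬝ᵥ e j = if i = j then (1 : ℝ) else 0) →
        ∑ k ∈ Finset.univ.filter (fun k : Fin n => q ≤ (k : ℕ)),
            ∑ i ∈ Finset.univ.filter (fun i : Fin n => (i : ℕ) < q),
              (2 * sffInner n p Hm (e i) (e k) (e i) (e k)
                - sffInner n p Hm (e i) (e i) (e k) (e k))
          < (q : ℝ) * ((n : ℝ) - q) * c := by
  intro q hq hqn e he
  have hE : Matrix.of e * (Matrix.of e)ᵀ = 1 := by
    ext i j
    simpa [Matrix.mul_apply, Matrix.one_apply, dotProduct] using he i j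
  set s : Finset (Fin n) := Finset.univ.filter (fun i : Fin n => (i : ℕ) < q) with hs_def
  have hsc_def : Finset.univ.filter (fun k : Fin n => q ≤ (k : ℕ)) = sᶜ := by
    ext k
    simp [hs_def]
  have hcard : s.card = q := by
    simp [hs_def, Fin.card_filter_val_lt]
    omega
  have hs : (s.card : ℝ) = q := by rw [hcard]
  have hsc : (sᶜ.card : ℝ) = (n : ℝ) - q := by
    rw [Finset.card_compl, hcard, Fintype.card_fin, Nat.cast_sub (by omega)]
  have hn' : (4 : ℝ) ≤ n := by exact_mod_cast hn
  have hq' : (2 : ℝ) ≤ q := by exact_mod_cast hq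
  have hqn' : 2 * (q : ℝ) ≤ n := by exact_mod_cast hqn
  set M : Fin p → Matrix (Fin n) (Fin n) ℝ :=
    fun α => Matrix.of e * Hm α * (Matrix.of e)ᵀ with hM_def
  have hMsymm : ∀ α, (M α).IsSymm := fun α => by
    simp [hM_def, Matrix.IsSymm, Matrix.transpose_mul, Matrix.mul_assoc, (hsym α).eq]
  have hMtr : ∀ α, (M α).trace = (Hm α).trace := fun α => trace_conj_of_orthogonal hE _
  have hsff : ∀ i j α, sff n p Hm (e i) (e j) α = M α i j := fun i j α =>
    (mulVec_dotProduct_eq_conj (Hm α) (Matrix.of e) i j).trans ((hMsymm α).apply i j)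
  have hS : ∑ α, ∑ i, ∑ j, M α i j ^ 2 = sqNormSff n p Hm :=
    Finset.sum_congr rfl fun α _ => sum_sq_conj_of_orthogonal hE _
  have hric : ∀ k, ricci n p Hm c (e k) =
      (n - 1) * c + ∑ α, ((M α).trace * M α k k - ∑ j, M α k j ^ 2) := by
    intro k
    unfold ricci
    congr 1
    refine Finset.sum_congr rfl fun α _ => ?_
    rw [hMtr, ← hsff k k α]
    exact congrArg _ (mulVec_dotProduct_self_eq_sum_conj hE (hsym α) k)
  set δ : ℝ := 2 * ((-1 : ℝ) ^ n + 3) / (2 * (n : ℝ) + ((-1 : ℝ) ^ n + 3)) with hδ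
  set Hsq := meanCurvSq n p Hm with hHsq
  obtain ⟨r, hr⟩ : ∃ r : ℝ, r * (n - 2) = n - 2 * q :=
    ⟨(n - 2 * q) / (n - 2), div_mul_cancel₀ _ (by linarith)⟩
  have hr0 : 0 ≤ r := by
    by_contra! h
    nlinarith
  have hricsum : ∑ α, ∑ k ∈ sᶜ, ((M α).trace * M α k k - ∑ j, M α k j ^ 2) ≤
      ((n : ℝ) - q) * (((n : ℝ) - 2 + δ) * (c + Hsq) - (n - 1) * c) := by
    rw [Finset.sum_comm, ← hsc, ← nsmul_eq_mul]
    refine Finset.sum_le_card_nsmul _ _ _ fun k _ => ?_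
    have h := hRic (e k) (by simp [he])
    rw [hric] at h
    linarith
  have hsum : ∑ k ∈ sᶜ, ∑ i ∈ s, (2 * sffInner n p Hm (e i) (e k) (e i) (e k)
        - sffInner n p Hm (e i) (e i) (e k) (e k)) =
      ∑ α, ∑ k ∈ sᶜ, ∑ i ∈ s, (2 * (M α i k * M α i k) - M α i i * M α k k) := by
    simp_rw [sffInner, hsff, Finset.mul_sum, ← Finset.sum_sub_distrib]
    exact (Finset.sum_congr rfl fun k _ => Finset.sum_comm).trans Finset.sum_comm
  have hle := Finset.sum_le_sum fun α (_ : α ∈ Finset.univ) =>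
    lawsonSimons_le (M α) (hMsymm α) s (r := r) (t := (Hm α).trace / n) hs hsc hq' (by linarith)
      (by linear_combination hr) (by rw [hMtr]; field_simp; ring)
  simp only [Finset.sum_add_distrib, Finset.sum_sub_distrib, ← Finset.mul_sum] at hle
  simp only [Finset.sum_sub_distrib, ← Finset.mul_sum] at hricsum
  have hH : ∑ α, ((Hm α).trace / n) ^ 2 = Hsq := rfl
  rw [hS, hH, add_sub_cancel] at hle
  rw [hsc_def, hsum]
  simp only [Finset.sum_sub_distrib, ← Finset.mul_sum]
  refine hle.trans_lt ?_
  have hφ : sqNormSff n p Hm - n * Hsq < n * (c + Hsq) := by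
    unfold scalarCurv at hR
    rw [← hHsq] at hR
    linarith
  have hK : 0 ≤ c + Hsq := by
    have : 0 ≤ Hsq := Finset.sum_nonneg fun α _ => sq_nonneg _
    positivity
  have hC : 0 < (q : ℝ) * (n - q + r) / n := by
    have : 0 < (n : ℝ) - q + r := by linarith
    positivity
  have hpinch : r * (q - ((n : ℝ) - q) * (1 - δ)) ≤ 0 := by
    rcases hqn.eq_or_lt with h | h
    · have h' : (n : ℝ) = 2 * q := by exact_mod_cast h.symm
      have : r = 0 := by
        rcases mul_eq_zero.1 (hr.trans (sub_eq_zero.2 h')) with h0 | h0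
        · exact h0
        · linarith
      simp [this]
    · exact mul_nonpos_of_nonneg_of_nonpos hr0 (sub_nonpos.2 (le_mul_one_sub_pinching hn h))
  have h1 := mul_lt_mul_of_pos_left hφ hC
  have h2 := mul_le_mul_of_nonneg_left hricsum hr0
  have h3 := mul_le_mul_of_nonneg_right hpinch hK
  have h4 : (q : ℝ) * (n - q + r) / n * (n * (c + Hsq)) = q * (n - q + r) * (c + Hsq) := by
    field_simp
  rw [h4] at h1
  linarith
end
end

section
/- Let n ≥ 4, p ≥ 1, let H_1,…,H_p be real symmetric n×n matrices and c ≥ 0 a real number. Set σ_n = sgn(n−4)·((−1)ⁿ+3), where sgn is the standard sign function. Assume R > n(n−2)(c+H²) and that for every pair of orthonormal unit vectors u, v ∈ ℝⁿ one has Ric(u) + Ric(v) ≥ 2(n−2−2σ_n/(2n−σ_n))(c+H²). Then for every integer q with 2 ≤ q ≤ n/2 and every orthonormal basis e_1,…,e_n of ℝⁿ, Σ_{k=q+1}^n Σ_{i=1}^q [2‖h(e_i,e_k)‖² − ⟨h(e_i,e_i), h(e_k,e_k)⟩] < q(n−q)c. -/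
open Matrix BigOperators

noncomputable section

open Finset in
/-- If all pairwise sums of a family are at least `2 * b`, its average is at least `b`. -/
lemma card_mul_le_sum_of_pairwise {ι : Type*} [DecidableEq ι] (s : Finset ι) (hs : 2 ≤ #s)
    (f : ι → ℝ) (b : ℝ) (h : ∀ i ∈ s, ∀ j ∈ s, i ≠ j → 2 * b ≤ f i + f j) :
    #s * b ≤ ∑ i ∈ s, f i := by
  have hpos : 0 ≤ ∑ i ∈ s, ∑ j ∈ s.erase i, (f i + f j - 2 * b) := by
    refine sum_nonneg fun i hi => sum_nonneg fun j hj => ?_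
    have := h i hi j (mem_of_mem_erase hj) (ne_of_mem_erase hj).symm
    linarith
  have heq : ∀ i ∈ s, ∑ j ∈ s.erase i, (f i + f j - 2 * b)
      = #s * f i + ∑ j ∈ s, f j - #s * (2 * b) - 2 * f i + 2 * b := by
    intro i hi
    have h1 := add_sum_erase s (fun j => f i + f j - 2 * b) hi
    simp only [sum_sub_distrib, sum_add_distrib, sum_const, nsmul_eq_mul] at h1 ⊢
    linarith
  rw [sum_congr rfl heq] at hpos
  simp only [sum_sub_distrib, sum_add_distrib, sum_const, nsmul_eq_mul, ← mul_sum] at hpos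
  have hs' : (2 : ℝ) ≤ #s := by exact_mod_cast hs
  have h2 : 0 ≤ (2 * ((#s : ℝ) - 1)) * (∑ i ∈ s, f i - #s * b) := by linarith
  have := nonneg_of_mul_nonneg_right h2 (by linarith)
  linarith

/-- The scalar inequality relating the block traces `P`, `Q` and the squared block norms
`A`, `M`, `C` of a symmetric matrix of size `n` whose first diagonal block has size `q`. -/
lemma block_scalar_inequality (n q P Q A M C : ℝ) (hq : 2 ≤ q) (hqn : 2 * q ≤ n)
    (hP : P ^ 2 ≤ q * A) (hQ : Q ^ 2 ≤ (n - q) * C) (hM : 0 ≤ M) :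
    2 * M - P * Q + q * (n - q) * ((P + Q) / n) ^ 2
        + (n - 2 * q) / (n - 2)
          * ((P + Q) * P - A - M - q * (n - 1) * ((P + Q) / n) ^ 2)
      ≤ (q - (n - 2 * q) / (n - 2)) * (n - q) / n
          * (A + 2 * M + C - n * ((P + Q) / n) ^ 2) := by
  have hn : 0 < n := by linarith
  have hn2 : 0 < n - 2 := by linarith
  have hnq : 0 < n - q := by linarith
  have hq0 : 0 < q := by linarith
  set μ := (n - 2 * q) / (n - 2) with hμ
  set ν := (q - μ) * (n - q) / n with hν
  have hμ0 : 0 ≤ μ := div_nonneg (by linarith) hn2.le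
  have hμ1 : μ ≤ 1 := (div_le_one hn2).2 (by linarith)
  have hν0 : 0 ≤ ν := div_nonneg (mul_nonneg (by linarith) hnq.le) hn.le
  have hνM : 0 ≤ 2 * ν - 2 + μ := by
    have : (q - μ) / 2 ≤ ν := by
      rw [hν, div_le_div_iff₀ two_pos hn]
      nlinarith
    linarith
  have hA : P ^ 2 / q ≤ A := (div_le_iff₀' hq0).2 hP
  have hC : Q ^ 2 / (n - q) ≤ C := (div_le_iff₀' hnq).2 hQ
  have key : ν * (A + 2 * M + C - n * ((P + Q) / n) ^ 2)
      - (2 * M - P * Q + q * (n - q) * ((P + Q) / n) ^ 2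
        + μ * ((P + Q) * P - A - M - q * (n - 1) * ((P + Q) / n) ^ 2))
      = (2 * ν - 2 + μ) * M + (ν + μ) * (A - P ^ 2 / q) + ν * (C - Q ^ 2 / (n - q)) := by
    rw [hν, hμ]
    field_simp
    ring
  have h1 := mul_nonneg hνM hM
  have h2 := mul_nonneg (add_nonneg hν0 hμ0) (sub_nonneg.2 hA)
  have h3 := mul_nonneg hν0 (sub_nonneg.2 hC)
  linarith

lemma sum_linear_le {ι : Type*} [Fintype ι] {D t r F : ι → ℝ} {a b μ ν m : ℝ}
    (h : ∀ α, D α + a * t α + μ * (r α - b * t α) ≤ ν * (F α - m * t α)) :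
    ∑ α, D α + a * ∑ α, t α + μ * (∑ α, r α - b * ∑ α, t α)
      ≤ ν * (∑ α, F α - m * ∑ α, t α) := by
  have := Finset.sum_le_sum fun α (_ : α ∈ Finset.univ) => h α
  simpa only [Finset.sum_add_distrib, Finset.sum_sub_distrib, ← Finset.mul_sum] using this

open Finset in
lemma sq_sum_diag_le_card_mul {ι : Type*} (s : Finset ι) (B : Matrix ι ι ℝ) :
    (∑ i ∈ s, B i i) ^ 2 ≤ #s * ∑ i ∈ s, ∑ j ∈ s, B i j ^ 2 := by
  refine sq_sum_le_card_mul_sum_sq.trans ?_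
  gcongr with i hi
  exact single_le_sum (f := fun j => B i j ^ 2) (fun j _ => sq_nonneg _) hi

open Finset in
lemma symm_block_inequality {n : ℕ} (B : Matrix (Fin n) (Fin n) ℝ) (hB : B.IsSymm)
    (s : Finset (Fin n)) (hs : 2 ≤ #s) (hsn : 2 * #s ≤ n) :
    ∑ k ∈ sᶜ, ∑ i ∈ s, (2 * (B i k * B i k) - B i i * B k k)
        + #s * (n - #s) * (B.trace / n) ^ 2
        + ((n : ℝ) - 2 * #s) / (n - 2)
          * (∑ i ∈ s, (B.trace * B i i - ∑ j, B i j ^ 2)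
            - #s * (n - 1) * (B.trace / n) ^ 2)
      ≤ (#s - ((n : ℝ) - 2 * #s) / (n - 2)) * (n - #s) / n
          * (∑ i, ∑ j, B i j ^ 2 - n * (B.trace / n) ^ 2) := by
  have hcard : ((#sᶜ : ℕ) : ℝ) = n - #s := by
    rw [card_compl, Fintype.card_fin, Nat.cast_sub (by omega)]
  have htr : B.trace = ∑ i ∈ s, B i i + ∑ k ∈ sᶜ, B k k :=
    (sum_add_sum_compl s fun i => B i i).symm
  have hM : ∑ k ∈ sᶜ, ∑ i ∈ s, B k i ^ 2 = ∑ i ∈ s, ∑ k ∈ sᶜ, B i k ^ 2 := by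
    rw [sum_comm]
    simp_rw [fun i k => hB.apply i k]
  have hrow (i) : ∑ j, B i j ^ 2 = ∑ j ∈ s, B i j ^ 2 + ∑ j ∈ sᶜ, B i j ^ 2 :=
    (sum_add_sum_compl s _).symm
  have hF : ∑ i, ∑ j, B i j ^ 2 = ∑ i ∈ s, ∑ j ∈ s, B i j ^ 2
      + 2 * ∑ i ∈ s, ∑ k ∈ sᶜ, B i k ^ 2 + ∑ i ∈ sᶜ, ∑ j ∈ sᶜ, B i j ^ 2 := by
    rw [← sum_add_sum_compl s]
    simp_rw [hrow, sum_add_distrib, hM]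
    ring
  have hD : ∑ k ∈ sᶜ, ∑ i ∈ s, (2 * (B i k * B i k) - B i i * B k k)
      = 2 * ∑ i ∈ s, ∑ k ∈ sᶜ, B i k ^ 2 - (∑ i ∈ s, B i i) * ∑ k ∈ sᶜ, B k k := by
    rw [sum_comm, sum_mul_sum]
    simp_rw [sum_sub_distrib, mul_sum, ← pow_two]
  have hRic : ∑ i ∈ s, (B.trace * B i i - ∑ j, B i j ^ 2)
      = B.trace * ∑ i ∈ s, B i i - ∑ i ∈ s, ∑ j ∈ s, B i j ^ 2
        - ∑ i ∈ s, ∑ k ∈ sᶜ, B i k ^ 2 := by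
    simp_rw [hrow, sum_sub_distrib, sum_add_distrib, mul_sum]
    ring
  have hC := sq_sum_diag_le_card_mul sᶜ B
  rw [hcard] at hC
  rw [hD, hRic, hF, htr]
  exact block_scalar_inequality n #s _ _ _ _ _ (by exact_mod_cast hs) (by exact_mod_cast hsn)
    (sq_sum_diag_le_card_mul s B) hC (sum_nonneg fun _ _ => sum_nonneg fun _ _ => sq_nonneg _)

section OrthonormalFrame

variable {n : ℕ} (A E : Matrix (Fin n) (Fin n) ℝ)

lemma mul_mul_transpose_apply (i j : Fin n) :
    (E * A * Eᵀ) i j = A.mulVec (E j) ⬝ᵥ E i := by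
  rw [Matrix.mul_assoc, Matrix.mul_apply, dotProduct_comm]
  rfl

lemma trace_mul_mul_transpose (hE : E * Eᵀ = 1) : (E * A * Eᵀ).trace = A.trace := by
  rw [Matrix.trace_mul_comm, ← Matrix.mul_assoc, mul_eq_one_comm.1 hE, Matrix.one_mul]

lemma isSymm_mul_mul_transpose (hA : A.IsSymm) : (E * A * Eᵀ).IsSymm := by
  simp [Matrix.IsSymm, Matrix.transpose_mul, hA.eq, Matrix.mul_assoc]

lemma sum_sq_eq_trace : ∑ i, ∑ j, A i j ^ 2 = (A * Aᵀ).trace := by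
  simp [Matrix.trace, Matrix.mul_apply, pow_two]

lemma mul_mul_transpose_mul_self (hA : A.IsSymm) (hE : E * Eᵀ = 1) :
    (E * A * Eᵀ) * (E * A * Eᵀ)ᵀ = E * (A * Aᵀ) * Eᵀ := by
  have hE' : Eᵀ * E = 1 := mul_eq_one_comm.1 hE
  rw [(isSymm_mul_mul_transpose A E hA).eq, hA.eq]
  calc E * A * Eᵀ * (E * A * Eᵀ) = E * A * (Eᵀ * E) * A * Eᵀ := by
        simp only [Matrix.mul_assoc]
    _ = E * (A * A) * Eᵀ := by rw [hE', Matrix.mul_one, Matrix.mul_assoc E A A]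

lemma sum_sq_mul_mul_transpose (hA : A.IsSymm) (hE : E * Eᵀ = 1) :
    ∑ i, ∑ j, (E * A * Eᵀ) i j ^ 2 = ∑ i, ∑ j, A i j ^ 2 := by
  rw [sum_sq_eq_trace, sum_sq_eq_trace, mul_mul_transpose_mul_self A E hA hE,
    trace_mul_mul_transpose _ E hE]

lemma mulVec_dotProduct_mulVec_eq_sum_sq (hA : A.IsSymm) (hE : E * Eᵀ = 1) (i : Fin n) :
    A.mulVec (E i) ⬝ᵥ A.mulVec (E i) = ∑ j, (E * A * Eᵀ) i j ^ 2 := by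
  have h : ∑ j, (E * A * Eᵀ) i j ^ 2 = ((E * A * Eᵀ) * (E * A * Eᵀ)ᵀ) i i :=
    Finset.sum_congr rfl fun j _ => pow_two _
  rw [h, mul_mul_transpose_mul_self A E hA hE, mul_mul_transpose_apply, hA.eq,
    ← Matrix.mulVec_mulVec, dotProduct_comm _ (E i), Matrix.dotProduct_mulVec (E i),
    ← Matrix.mulVec_transpose, hA.eq]

end OrthonormalFrame

open Finset in
lemma sum_ricci_eq (n p : ℕ) (Hm : Fin p → Matrix (Fin n) (Fin n) ℝ)
    (hsym : ∀ α, (Hm α).IsSymm) (c : ℝ) (E : Matrix (Fin n) (Fin n) ℝ) (hE : E * Eᵀ = 1)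
    (s : Finset (Fin n)) :
    ∑ i ∈ s, ricci n p Hm c (E i) = #s * ((n - 1) * c)
      + ∑ α, ∑ i ∈ s, ((E * Hm α * Eᵀ).trace * (E * Hm α * Eᵀ) i i
        - ∑ j, (E * Hm α * Eᵀ) i j ^ 2) := by
  simp only [ricci, sum_add_distrib, sum_const, nsmul_eq_mul]
  rw [sum_comm]
  congr 1
  refine sum_congr rfl fun α _ => sum_congr rfl fun i _ => ?_
  rw [mulVec_dotProduct_mulVec_eq_sum_sq _ E (hsym α) hE, ← mul_mul_transpose_apply,
    trace_mul_mul_transpose _ E hE]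

open Finset in
/-- The Lawson–Simons inequality for a splitting `s`, `sᶜ` of an orthonormal frame, under a lower
bound `b * (c + H²)` for the averaged Ricci curvature over `s`. -/
lemma lawsonSimons_of_sum_ricci (n p : ℕ) (Hm : Fin p → Matrix (Fin n) (Fin n) ℝ)
    (hsym : ∀ α, (Hm α).IsSymm) (c : ℝ) (hc : 0 ≤ c) (b : ℝ)
    (hR : scalarCurv n p Hm c > (n : ℝ) * ((n : ℝ) - 2) * (c + meanCurvSq n p Hm))
    (E : Matrix (Fin n) (Fin n) ℝ) (hE : E * Eᵀ = 1)
    (s : Finset (Fin n)) (hs : 2 ≤ #s) (hsn : 2 * #s ≤ n)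
    (hb : 2 * #s = n ∨ #s * ((n : ℝ) - 1 - b) ≤ n - #s)
    (hRic : #s * (b * (c + meanCurvSq n p Hm)) ≤ ∑ i ∈ s, ricci n p Hm c (E i)) :
    ∑ k ∈ sᶜ, ∑ i ∈ s, (2 * sffInner n p Hm (E i) (E k) (E i) (E k)
        - sffInner n p Hm (E i) (E i) (E k) (E k)) < #s * ((n : ℝ) - #s) * c := by
  have hq : (2 : ℝ) ≤ #s := by exact_mod_cast hs
  have hqn : 2 * (#s : ℝ) ≤ n := by exact_mod_cast hsn
  set B : Fin p → Matrix (Fin n) (Fin n) ℝ := fun α => E * Hm α * Eᵀ with hBdef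
  have hB (α) : (B α).IsSymm := isSymm_mul_mul_transpose _ E (hsym α)
  have hH : meanCurvSq n p Hm = ∑ α, ((B α).trace / n) ^ 2 := by
    simp only [meanCurvSq, hBdef, trace_mul_mul_transpose _ E hE]
  have hS : sqNormSff n p Hm = ∑ α, ∑ i, ∑ j, B α i j ^ 2 :=
    sum_congr rfl fun α _ => (sum_sq_mul_mul_transpose _ E (hsym α) hE).symm
  have hsff (α i k) : sff n p Hm (E i) (E k) α = B α i k := by
    rw [← (hB α).apply i k]
    exact (mul_mul_transpose_apply _ E k i).symm
  have hD : ∑ k ∈ sᶜ, ∑ i ∈ s, (2 * sffInner n p Hm (E i) (E k) (E i) (E k)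
        - sffInner n p Hm (E i) (E i) (E k) (E k))
      = ∑ α, ∑ k ∈ sᶜ, ∑ i ∈ s, (2 * (B α i k * B α i k) - B α i i * B α k k) := by
    symm
    rw [sum_comm]
    refine sum_congr rfl fun k _ => ?_
    rw [sum_comm]
    refine sum_congr rfl fun i _ => ?_
    simp only [sffInner, hsff, mul_sum, sum_sub_distrib]
  have hsum := sum_linear_le fun α => symm_block_inequality (B α) (hB α) s hs hsn
  have hRic' := hRic.trans_eq (sum_ricci_eq n p Hm hsym c E hE s)
  change _ ≤ #s * ((n - 1) * c)
    + ∑ α, ∑ i ∈ s, ((B α).trace * B α i i - ∑ j, B α i j ^ 2) at hRic'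
  rw [← hS, ← hH] at hsum
  rw [hD]
  unfold scalarCurv at hR
  have hH0 : 0 ≤ meanCurvSq n p Hm := sum_nonneg fun _ _ => sq_nonneg _
  set h2 := meanCurvSq n p Hm
  set μ := ((n : ℝ) - 2 * #s) / (n - 2) with hμ
  have hμ0 : 0 ≤ μ := div_nonneg (by linarith) (by linarith)
  have hμ1 : μ ≤ 1 := (div_le_one (by linarith)).2 (by linarith)
  set ν := ((#s : ℝ) - μ) * (n - #s) / n with hν
  have hνn : ν * n = (#s - μ) * (n - #s) := by
    rw [hν, div_mul_cancel₀]
    linarith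
  have hν0 : 0 < ν := div_pos (mul_pos (by linarith) (by linarith)) (by linarith)
  have hb' : μ * (#s * ((n : ℝ) - 1 - b)) ≤ μ * (n - #s) := by
    rcases hb with h | h
    · have : μ = 0 := by
        have h' : (n : ℝ) - 2 * #s = 0 := by
          rw [sub_eq_zero]
          exact_mod_cast h.symm
        rw [hμ, h', zero_div]
      simp [this]
    · exact mul_le_mul_of_nonneg_left h hμ0
  have h1 := mul_le_mul_of_nonneg_right hb' (add_nonneg hc hH0)
  have h3 := mul_le_mul_of_nonneg_left hRic' hμ0
  have h4 : ν * (sqNormSff n p Hm - n * h2) < ν * (n * (c + h2)) :=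
    mul_lt_mul_of_pos_left (by linarith) hν0
  have h5 : ν * (n * (c + h2)) = (#s - μ) * (n - #s) * (c + h2) := by
    rw [← mul_assoc, hνn]
  linarith

/-- For `2 * q ≤ n` with `n ≠ 2 * q`, the numerical Ricci bound of the theorem is large enough. -/
lemma ricci_bound_numeric (n q : ℕ) (hn : 4 ≤ n) (hqn : 2 * q ≤ n) (hne : 2 * q ≠ n) :
    (q : ℝ) * ((n : ℝ) - 1 - ((n : ℝ) - 2 - 2 * (Real.sign ((n : ℝ) - 4) * ((-1 : ℝ) ^ n + 3))
      / (2 * (n : ℝ) - Real.sign ((n : ℝ) - 4) * ((-1 : ℝ) ^ n + 3)))) ≤ n - q := by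
  have hn' : (4 : ℝ) ≤ n := by exact_mod_cast hn
  have main : ∀ σ : ℝ, 0 < 2 * (n : ℝ) - σ → 4 * (q : ℝ) ≤ 2 * n - σ →
      (q : ℝ) * ((n : ℝ) - 1 - ((n : ℝ) - 2 - 2 * σ / (2 * n - σ))) ≤ n - q := by
    intro σ hσ hσq
    have hx : 2 * σ / (2 * n - σ) * (2 * n - σ) = 2 * σ := div_mul_cancel₀ _ hσ.ne'
    refine le_of_mul_le_mul_right ?_ hσ
    have : (q : ℝ) * ((n : ℝ) - 1 - ((n : ℝ) - 2 - 2 * σ / (2 * n - σ))) * (2 * n - σ)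
        = q * (2 * n - σ) + q * (2 * σ / (2 * n - σ) * (2 * n - σ)) := by
      ring
    rw [this, hx]
    nlinarith
  rcases hn.eq_or_lt with h | h
  · have h0 : (n : ℝ) - 4 = 0 := by rw [← h]; norm_num
    have hq : 2 * (q : ℝ) ≤ n := by exact_mod_cast hqn
    rw [h0, Real.sign_zero, zero_mul]
    exact main 0 (by linarith) (by linarith)
  · have h0 : (4 : ℝ) < n := by exact_mod_cast h
    rw [Real.sign_of_pos (by linarith), one_mul]
    rcases n.even_or_odd with he | ho
    · have hq : 2 * (q : ℝ) + 2 ≤ n := by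
        obtain ⟨m, rfl⟩ := he
        exact_mod_cast (by omega : 2 * q + 2 ≤ m + m)
      rw [he.neg_one_pow]
      exact main _ (by linarith) (by linarith)
    · have hq : 2 * (q : ℝ) + 1 ≤ n := by exact_mod_cast (by omega : 2 * q + 1 ≤ n)
      rw [ho.neg_one_pow]
      exact main _ (by linarith) (by linarith)

theorem stmt_19 (n p : ℕ) (hn : 4 ≤ n) (hp : 1 ≤ p)
    (Hm : Fin p → Matrix (Fin n) (Fin n) ℝ) (hsym : ∀ α, (Hm α).IsSymm)
    (c : ℝ) (hc : 0 ≤ c)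
    (hR : scalarCurv n p Hm c > (n : ℝ) * ((n : ℝ) - 2) * (c + meanCurvSq n p Hm))
    (hRic : ∀ u v : Fin n → ℝ, u ⬝ᵥ u = 1 → v ⬝ᵥ v = 1 → u ⬝ᵥ v = 0 →
      ricci n p Hm c u + ricci n p Hm c v ≥
        2 * ((n : ℝ) - 2 - 2 * (Real.sign ((n : ℝ) - 4) * ((-1 : ℝ) ^ n + 3)) / (2 * (n : ℝ) - Real.sign ((n : ℝ) - 4) * ((-1 : ℝ) ^ n + 3)))
          * (c + meanCurvSq n p Hm)) :
    ∀ q : ℕ, 2 ≤ q → 2 * q ≤ n →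
      ∀ e : Fin n → Fin n → ℝ, (∀ i j, e i ⬝ᵥ e j = if i = j then (1 : ℝ) else 0) →
        ∑ k ∈ Finset.univ.filter (fun k : Fin n => q ≤ (k : ℕ)),
            ∑ i ∈ Finset.univ.filter (fun i : Fin n => (i : ℕ) < q),
              (2 * sffInner n p Hm (e i) (e k) (e i) (e k)
                - sffInner n p Hm (e i) (e i) (e k) (e k))
          < (q : ℝ) * ((n : ℝ) - q) * c := by
  intro q hq hqn e he
  set s := Finset.univ.filter fun i : Fin n => (i : ℕ) < q with hs
  have hcompl : Finset.univ.filter (fun k : Fin n => q ≤ (k : ℕ)) = sᶜ := by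
    ext k
    simp [hs]
  have hcard : s.card = q := by
    rw [hs, Fin.card_filter_val_lt]
    omega
  have hE : (Matrix.of e) * (Matrix.of e)ᵀ = 1 := by
    ext i j
    rw [Matrix.one_apply, ← he i j]
    rfl
  rw [hcompl]
  have key := lawsonSimons_of_sum_ricci n p Hm hsym c hc _ hR (Matrix.of e) hE s
    (by omega) (by omega)
    (by
      rw [hcard]
      exact (eq_or_ne (2 * q) n).imp_right fun h => ricci_bound_numeric n q hn hqn h)
    (card_mul_le_sum_of_pairwise s (by omega) _ _ fun i _ j _ hij => by
      have h := hRic (e i) (e j) (by simp [he]) (by simp [he]) (by simp [he, hij])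
      rw [← mul_assoc]
      exact h)
  rw [hcard] at key
  exact key
end
end
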